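/- arXiv:1903.08079 — 2 statements merged into one kernel-verified Lean document; each statement's English description precedes it below -/
import Mathlib

section
/- If A is a coneat quasi injective left R-module, then the quotient of its endomorphism ring End_R(A) by its Jacobson radical J is a von Neumann regular ring and is injective as a module over itself (i.e. End_R(A)/J is right self-injective). -/
/-!
Basic notions from the theory of coneat exact sequences.

A short exact sequence `0 → A → B → C → 0` of left `R`-modules is *coneat exact* if for every
simple right `R`-module `S` the induced map `S ⊗[R] A → S ⊗[R] B` is injective.  Since every
simple right `R`-module is isomorphic to `R ⧸ I` for a maximal right ideal `I` (realized below
as a left ideal `I : Ideal Rᵐᵒᵖ`), and since `(R ⧸ I) ⊗[R] B ≅ B ⧸ I•B` (as abelian groups,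
where `I•B` is the additive subgroup generated by the products `i • b`, `i ∈ I`, `b ∈ B`),
this is equivalent to the elementwise condition `A ∩ I•B ⊆ I•A` for every maximal right
ideal `I`, which is the formulation used here (Mathlib has no tensor product of a right module
with a left module over a noncommutative ring).
-/

universe u v

section Defs

variable (R : Type u) [Ring R]

/-- The additive subgroup of a left `R`-module `B` generated by the products `i • n` with
`i` in a right ideal `I` (realized as a left ideal of `Rᵐᵒᵖ`) and `n ∈ N`. -/
def rIdealSMul {B : Type v} [AddCommGroup B] [Module R B] (I : Ideal Rᵐᵒᵖ) (N : Set B) :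
    AddSubgroup B :=
  AddSubgroup.closure {x : B | ∃ i ∈ I, ∃ n ∈ N, x = MulOpposite.unop i • n}

/-- `A` is a *coneat submodule* of `B` : the sequence `0 → A → B → B ⧸ A → 0` remains exact
after tensoring with every simple right `R`-module, i.e. `A ∩ I•B ⊆ I•A` for every maximal
right ideal `I` of `R`. -/
def IsConeatSubmodule {B : Type v} [AddCommGroup B] [Module R B] (A : Submodule R B) : Prop :=
  ∀ I : Ideal Rᵐᵒᵖ, I.IsMaximal → ∀ a : B, a ∈ A →
    a ∈ rIdealSMul R I (Set.univ : Set B) → a ∈ rIdealSMul R I (A : Set B)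

/-- The short exact sequence `0 → A –f→ B –g→ C → 0` is *coneat exact*. -/
def IsConeatExactSeq {A B C : Type v} [AddCommGroup A] [Module R A] [AddCommGroup B] [Module R B]
    [AddCommGroup C] [Module R C] (f : A →ₗ[R] B) (g : B →ₗ[R] C) : Prop :=
  Function.Injective f ∧ Function.Surjective g ∧ Function.Exact f g ∧
    IsConeatSubmodule R (LinearMap.range f)

/-- A left `R`-module `M` is *coneat injective* if for every coneat submodule `A` of a left
`R`-module `B`, every homomorphism `A → M` extends to `B`. -/
def IsConeatInjective (M : Type v) [AddCommGroup M] [Module R M] : Prop :=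
  ∀ (B : ModuleCat.{v} R) (A : Submodule R B), IsConeatSubmodule R A →
    ∀ f : A →ₗ[R] M, ∃ g : B →ₗ[R] M, g.comp A.subtype = f

/-- `e : M → E` is a *coneat injective envelope* of `M` : `e` is injective, `E` is coneat
injective, every homomorphism from `M` to a coneat injective module factors through `e`, and
every endomorphism `f` of `E` with `f ∘ e = e` is an automorphism. -/
def IsConeatInjectiveEnvelope {M E : Type v} [AddCommGroup M] [Module R M] [AddCommGroup E]
    [Module R E] (e : M →ₗ[R] E) : Prop :=
  Function.Injective e ∧ IsConeatInjective R E ∧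
    (∀ (C : ModuleCat.{v} R), IsConeatInjective R C → ∀ g : M →ₗ[R] C,
      ∃ h : E →ₗ[R] C, h.comp e = g) ∧
    (∀ f : E →ₗ[R] E, f.comp e = e → Function.Bijective f)

/-- `M` is *`N`-coneat injective* if every homomorphism from a coneat submodule of `N`
to `M` extends to `N`. -/
def IsRelConeatInjective (M N : Type v) [AddCommGroup M] [Module R M] [AddCommGroup N]
    [Module R N] : Prop :=
  ∀ K : Submodule R N, IsConeatSubmodule R K →
    ∀ f : K →ₗ[R] M, ∃ g : N →ₗ[R] M, g.comp K.subtype = f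

/-- `M` is *quasi coneat injective* if it is `M`-coneat injective. -/
def IsQuasiConeatInjective (M : Type v) [AddCommGroup M] [Module R M] : Prop :=
  IsRelConeatInjective R M M

/-- `M` is *coneat-`N`-injective* if for (some, equivalently every) coneat injective envelope
`e : M → E`, every homomorphism `f : N → E` satisfies `f (N) ⊆ e (M)`. -/
def IsConeatRelInjective (M N : Type v) [AddCommGroup M] [Module R M] [AddCommGroup N]
    [Module R N] : Prop :=
  ∀ (E : ModuleCat.{v} R) (e : M →ₗ[R] E), IsConeatInjectiveEnvelope R e →
    ∀ f : N →ₗ[R] E, ∀ n : N, f n ∈ LinearMap.range e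

/-- `M` is *coneat quasi injective* if it is coneat-`M`-injective, i.e. fully invariant in its
coneat injective envelope. -/
def IsConeatQuasiInjective (M : Type v) [AddCommGroup M] [Module R M] : Prop :=
  IsConeatRelInjective R M M

/-- `A` is a *pure submodule* of `B` : the sequence `0 → A → B → B ⧸ A → 0` remains exact after
tensoring with every right `R`-module; elementwise (Cohn's criterion): every finite system of
linear equations `aᵢ = ∑ⱼ rᵢⱼ • xⱼ` with constants in `A` which is solvable in `B` is solvable
in `A`. -/
def IsPureSubmodule {B : Type v} [AddCommGroup B] [Module R B] (A : Submodule R B) : Prop :=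
  ∀ (m n : ℕ) (r : Fin m → Fin n → R) (a : Fin m → A),
    (∃ b : Fin n → B, ∀ i, (a i : B) = ∑ j, r i j • b j) →
    ∃ a' : Fin n → A, ∀ i, (a i : B) = ∑ j, r i j • (a' j : B)

/-- The short exact sequence `0 → A –f→ B –g→ C → 0` is *pure exact*. -/
def IsPureExactSeq {A B C : Type v} [AddCommGroup A] [Module R A] [AddCommGroup B] [Module R B]
    [AddCommGroup C] [Module R C] (f : A →ₗ[R] B) (g : B →ₗ[R] C) : Prop :=
  Function.Injective f ∧ Function.Surjective g ∧ Function.Exact f g ∧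
    IsPureSubmodule R (LinearMap.range f)

/-- A left `R`-module `M` is *pure injective* if for every pure submodule `A` of a left
`R`-module `B`, every homomorphism `A → M` extends to `B`. -/
def IsPureInjective (M : Type v) [AddCommGroup M] [Module R M] : Prop :=
  ∀ (B : ModuleCat.{v} R) (A : Submodule R B), IsPureSubmodule R A →
    ∀ f : A →ₗ[R] M, ∃ g : B →ₗ[R] M, g.comp A.subtype = f

/-- A right `R`-module `S` (i.e. a left `Rᵐᵒᵖ`-module) is *flat*, expressed through the
equational criterion (which over any ring is equivalent to `S ⊗[R] —` preserving injections):
every relation `∑ᵢ sᵢ aᵢ = 0` in `S` comes from relations in `R`. -/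
def IsFlatRightModule (S : Type v) [AddCommGroup S] [Module Rᵐᵒᵖ S] : Prop :=
  ∀ (m : ℕ) (a : Fin m → R) (s : Fin m → S),
    (∑ i, MulOpposite.op (a i) • s i) = 0 →
    ∃ (n : ℕ) (b : Fin n → Fin m → R) (t : Fin n → S),
      (∀ i, s i = ∑ j, MulOpposite.op (b j i) • t j) ∧ (∀ j, ∑ i, b j i * a i = 0)

/-- A left `R`-module `C` is *coneat flat* if `C ≅ B ⧸ A` for some coneat submodule `A ≤ B`. -/
def IsConeatFlat (C : Type v) [AddCommGroup C] [Module R C] : Prop :=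
  ∃ (B : ModuleCat.{v} R) (A : Submodule R B),
    IsConeatSubmodule R A ∧ Nonempty ((B ⧸ A) ≃ₗ[R] C)

end Defs

section RingTheory

variable {H : Type*} [Ring H]

lemma exists_mul_one_sub_eq_one_of_mem_jacobson {j : H}
    (hj : j ∈ TwoSidedIdeal.jacobson (⊥ : TwoSidedIdeal H)) : ∃ z, z * (1 - j) = 1 := by
  obtain ⟨z, hz⟩ := TwoSidedIdeal.mem_jacobson_iff.1 hj (-1)
  refine ⟨z, ?_⟩
  rw [TwoSidedIdeal.mem_bot, sub_eq_zero] at hz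
  rw [mul_sub, mul_one, ← hz, mul_neg_one, neg_mul, neg_add_eq_sub]

/-- A ring in which every left ideal `H * a` is generated, modulo the Jacobson radical, by an
idempotent `h * a`. -/
def IsSplitModJacobson (H : Type*) [Ring H] : Prop :=
  ∀ a : H, ∃ h : H, h * a * (h * a) = h * a ∧
    a - a * h * a ∈ TwoSidedIdeal.jacobson (⊥ : TwoSidedIdeal H)

/-- A system of equations `c * e = b e` in one unknown `c` is solvable as soon as all its finite
subsystems are. -/
def IsRightLinearlyCompact (H : Type*) [Ring H] : Prop :=
  ∀ (s : Set H) (b : H → H),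
    (∀ F : Finset H, (F : Set H) ⊆ s → ∃ c, ∀ e ∈ F, c * e = b e) → ∃ c, ∀ e ∈ s, c * e = b e

open Classical in
/-- Every element of every finite subset of `s` can be separated from the other elements by a
left multiplication. -/
def IsSeparatedFamily (s : Set H) : Prop :=
  ∀ F : Finset H, (F : Set H) ⊆ s → ∃ p : H → H, ∀ e ∈ F, ∀ e' ∈ F,
    p e * e' = if e' = e then e else 0

variable {K : Type*} [Ring K] {π : H →+* K}

lemma IsSplitModJacobson.exists_separating (hH : IsSplitModJacobson H)
    (hker : ∀ x, π x = 0 ↔ x ∈ TwoSidedIdeal.jacobson (⊥ : TwoSidedIdeal H))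
    {g e : H} (hg : g * g = g) (he : e * e = e)
    (hge : ∀ x y, π (g * x) = π (e * y) → π (e * y) = 0) :
    ∃ q, q * g = 0 ∧ q * e = e := by
  obtain ⟨h, -, hh⟩ := hH ((1 - g) * e)
  rw [← hker] at hh
  have h1 : π (e * (1 - h * ((1 - g) * e))) = 0 := by
    refine hge (e * (1 - h * ((1 - g) * e))) _ ?_
    rw [← sub_eq_zero, ← map_sub, ← neg_eq_zero, ← map_neg, ← hh]
    congr 1
    noncomm_ring
  set v := e * h * (1 - g) with hv
  have h2 : e - v * e ∈ TwoSidedIdeal.jacobson (⊥ : TwoSidedIdeal H) := by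
    rw [← hker, ← h1]
    congr 1
    rw [hv]
    noncomm_ring
  obtain ⟨z, hz⟩ := exists_mul_one_sub_eq_one_of_mem_jacobson h2
  refine ⟨z * v, ?_, ?_⟩
  · rw [hv, mul_assoc, mul_assoc, sub_mul, one_mul, hg, sub_self, mul_zero, mul_zero]
  · calc z * v * e = z * ((1 - (e - v * e)) * e) := by
          rw [sub_mul, sub_mul, one_mul, he, mul_assoc v, he, mul_assoc]; noncomm_ring
      _ = e := by rw [← mul_assoc, hz, one_mul]

lemma IsSeparatedFamily.insert (hH : IsSplitModJacobson H)
    (hker : ∀ x, π x = 0 ↔ x ∈ TwoSidedIdeal.jacobson (⊥ : TwoSidedIdeal H))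
    {s : Set H} (hs : IsSeparatedFamily s) (hidem : ∀ i ∈ s, i * i = i) {e : H} (he : e * e = e)
    (hse : ∀ (F : Finset H) (p : H → H) (y : H), (F : Set H) ⊆ s →
      π (∑ i ∈ F, i * p i) = π (e * y) → π (e * y) = 0) :
    IsSeparatedFamily (insert e s) := by
  classical
  intro F hF
  have hF' : ((F.erase e : Finset H) : Set H) ⊆ s := by
    intro i hi
    rw [Finset.coe_erase] at hi
    exact (hF hi.1).resolve_left hi.2
  obtain ⟨p, hp⟩ := hs _ hF'
  set g := ∑ i ∈ F.erase e, i * p i with hg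
  have hge : ∀ i ∈ F.erase e, g * i = i := by
    intro i hi
    rw [hg, Finset.sum_mul, Finset.sum_eq_single i]
    · rw [mul_assoc, hp i hi i hi, if_pos rfl, hidem i (hF' hi)]
    · intro j hj hji
      rw [mul_assoc, hp j hj i hi, if_neg hji.symm, mul_zero]
    · exact fun h => absurd hi h
  have hgg : g * g = g := by
    conv_lhs => rw [hg, ← hg, Finset.mul_sum]
    rw [hg]
    exact Finset.sum_congr rfl fun i hi => by rw [← mul_assoc, hge i hi]
  obtain ⟨q, hqg, hqe⟩ := hH.exists_separating hker hgg he fun x y hxy =>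
    hse (F.erase e) (fun i => p i * x) y hF' <| by
      rw [← hxy, hg, Finset.sum_mul]
      simp only [mul_assoc]
  have hqi : ∀ i ∈ F.erase e, q * i = 0 := by
    intro i hi
    rw [← hge i hi, ← mul_assoc, hqg, zero_mul]
  refine ⟨fun i => if i = e then q else p i * (1 - e * q), fun i hi j hj => ?_⟩
  dsimp only
  by_cases hie : i = e <;> by_cases hje : j = e
  · rw [if_pos hie, hje, hie, if_pos rfl, hqe]
  · rw [if_pos hie, if_neg (fun h => hje (h.trans hie)), hqi j (Finset.mem_erase.2 ⟨hje, hj⟩)]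
  · rw [if_neg hie, if_neg (fun h => hie (h.symm.trans hje)), hje, mul_assoc, sub_mul, one_mul,
      mul_assoc, hqe, he, sub_self, mul_zero]
  · rw [if_neg hie, mul_assoc, sub_mul, one_mul, mul_assoc,
      hqi j (Finset.mem_erase.2 ⟨hje, hj⟩), mul_zero, sub_zero,
      hp i (Finset.mem_erase.2 ⟨hie, hi⟩) j (Finset.mem_erase.2 ⟨hje, hj⟩)]

lemma IsSplitModJacobson.exists_eq_mul_mul (hH : IsSplitModJacobson H)
    (hker : ∀ x, π x = 0 ↔ x ∈ TwoSidedIdeal.jacobson (⊥ : TwoSidedIdeal H))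
    (hsurj : Function.Surjective π) (t : K) : ∃ u, t = t * u * t := by
  obtain ⟨a, rfl⟩ := hsurj t
  obtain ⟨h, -, hh⟩ := hH a
  refine ⟨π h, ?_⟩
  rw [← hker, map_sub, map_mul, map_mul, sub_eq_zero] at hh
  exact hh

lemma exists_maximal_isSeparatedFamily (P : H → Prop) :
    ∃ s : Set H, Maximal (fun s => (∀ e ∈ s, P e) ∧ IsSeparatedFamily s) s := by
  classical
  refine zorn_subset {s : Set H | (∀ e ∈ s, P e) ∧ IsSeparatedFamily s} fun c hc hchain => ?_
  rcases c.eq_empty_or_nonempty with rfl | hne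
  · refine ⟨∅, ⟨by simp, fun F hF => ⟨id, fun e he => ?_⟩⟩, by simp⟩
    exact absurd (hF he) (by simp)
  · refine ⟨⋃₀ c, ⟨fun e ⟨t, ht, het⟩ => (hc ht).1 e het, fun F hF => ?_⟩,
      fun t ht => Set.subset_sUnion_of_mem ht⟩
    obtain ⟨t, ht, hFt⟩ := DirectedOn.exists_mem_subset_of_finset_subset_biUnion hne
      (f := id) hchain.directedOn (s := F) (by simpa [Set.sUnion_eq_biUnion] using hF)
    exact (hc ht).2 F hFt

/-- Baer's criterion for the quotient, in terms of a right ideal `I` and a map `G` which is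
right linear on `I`. -/
lemma IsSplitModJacobson.exists_eq_mul_left (hH : IsSplitModJacobson H)
    (hcomp : IsRightLinearlyCompact H)
    (hker : ∀ x, π x = 0 ↔ x ∈ TwoSidedIdeal.jacobson (⊥ : TwoSidedIdeal H))
    (hsurj : Function.Surjective π) (I : AddSubgroup K) (hI : ∀ x ∈ I, ∀ y, x * y ∈ I)
    (G : I →+ K) (hG : ∀ (x : I) (y : K), G ⟨x * y, hI x x.2 y⟩ = G x * y) :
    ∃ c : K, ∀ x : I, G x = c * x := by
  classical
  obtain ⟨s, ⟨hsP, hsep⟩, hmax⟩ :=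
    exists_maximal_isSeparatedFamily (fun e : H => e * e = e ∧ π e ∈ I)
  have hb : ∀ e : H, ∃ b : H, ∀ he : π e ∈ I, π b = G ⟨π e, he⟩ := by
    intro e
    by_cases he : π e ∈ I
    · obtain ⟨b, hb⟩ := hsurj (G ⟨π e, he⟩)
      exact ⟨b, fun _ => hb⟩
    · exact ⟨0, fun h => absurd h he⟩
  choose b hb using hb
  obtain ⟨c, hc⟩ := hcomp s (fun e => b e * e) fun F hF => by
    obtain ⟨p, hp⟩ := hsep F hF
    refine ⟨∑ i ∈ F, b i * p i, fun e he => ?_⟩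
    rw [Finset.sum_mul, Finset.sum_eq_single e]
    · rw [mul_assoc, hp e he e he, if_pos rfl]
    · intro i hi hie
      rw [mul_assoc, hp i hi e he, if_neg hie.symm, mul_zero]
    · exact fun h => absurd he h
  set ψ : I →+ K := G - (AddMonoidHom.mulLeft (π c)).comp I.subtype with hψ
  have hψ_apply : ∀ x : I, ψ x = G x - π c * x := fun x => rfl
  have hψ_mul : ∀ (x : I) (y : K), ψ ⟨x * y, hI x x.2 y⟩ = ψ x * y := by
    intro x y
    rw [hψ_apply, hψ_apply, hG, sub_mul, mul_assoc]
  have hψ_s : ∀ e (he : e ∈ s), ψ ⟨π e, (hsP e he).2⟩ = 0 := by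
    intro e he
    rw [hψ_apply, sub_eq_zero, ← map_mul, hc e he, map_mul, hb e (hsP e he).2, ← hG]
    congr 2
    rw [← map_mul, (hsP e he).1]
  refine ⟨π c, fun x => ?_⟩
  rw [← sub_eq_zero, ← hψ_apply]
  by_contra hx
  obtain ⟨a, ha⟩ := hsurj x
  obtain ⟨β, hβ⟩ := hsurj (ψ x)
  obtain ⟨h, -, hh⟩ := hH β
  rw [← hker, map_sub, map_mul, map_mul, sub_eq_zero] at hh
  obtain ⟨k, hk, hk'⟩ := hH (a * h * β)
  rw [← hker, map_sub, sub_eq_zero] at hk'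
  set e := a * h * β * k * (a * h * β) * k with he
  have heI : ∀ y, π (e * y) ∈ I := fun y => by
    rw [he, show a * h * β * k * (a * h * β) * k * y = a * (h * β * k * (a * h * β) * k * y) by
      noncomm_ring, map_mul, ha]
    exact hI _ x.2 _
  have hψe : ∀ y, ψ ⟨π (e * y), heI y⟩ = π (β * k * (a * h * β) * k * y) := by
    intro y
    have h1 : (⟨π (e * y), heI y⟩ : I) =
        ⟨x * π (h * β * k * (a * h * β) * k * y), hI _ x.2 _⟩ := by
      rw [Subtype.mk.injEq, ← ha, ← map_mul, he]
      congr 1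
      noncomm_ring
    rw [h1, hψ_mul, ← hβ]
    simp only [map_mul, ← mul_assoc]
    rw [← hh]
  have hee : e * e = e := by
    have h2 : k * (a * h * β) * (k * (a * h * β)) * (k * (a * h * β)) = k * (a * h * β) := by
      rw [hk, hk]
    calc e * e = a * h * β * (k * (a * h * β) * (k * (a * h * β)) * (k * (a * h * β))) * k := by
          rw [he]; noncomm_ring
      _ = e := by rw [h2, he]; noncomm_ring
  have hea : π (e * (a * h * β)) = π (a * h * β) := by
    rw [hk', he, show a * h * β * k * (a * h * β) * k * (a * h * β) =
      a * h * β * (k * (a * h * β) * (k * (a * h * β))) by noncomm_ring, hk]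
    congr 1
    noncomm_ring
  have hψ_ne : ∀ y, ψ ⟨π (e * y), heI y⟩ = 0 → π (e * y) = 0 := by
    intro y hy
    rw [hψe] at hy
    rw [he, show a * h * β * k * (a * h * β) * k * y = a * h * (β * k * (a * h * β) * k * y) by
      noncomm_ring, map_mul, hy, mul_zero]
  have hsum : ∀ (F : Finset H) (p : H → H), (F : Set H) ⊆ s →
      ∃ hm : π (∑ i ∈ F, i * p i) ∈ I, ψ ⟨π (∑ i ∈ F, i * p i), hm⟩ = 0 := by
    intro F p hF
    have h3 : π (∑ i ∈ F, i * p i) ∈ ψ.ker.map I.subtype := by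
      rw [map_sum]
      refine AddSubgroup.sum_mem _ fun i hi => ?_
      rw [map_mul]
      refine ⟨⟨π i * π (p i), hI _ (hsP i (hF hi)).2 _⟩, ?_, rfl⟩
      have h4 := hψ_mul ⟨π i, (hsP i (hF hi)).2⟩ (π (p i))
      rw [hψ_s i (hF hi), zero_mul] at h4
      exact h4
    obtain ⟨z, hz, hz'⟩ := h3
    refine ⟨hz' ▸ z.2, ?_⟩
    rw [← hz]
    congr 1
    exact Subtype.ext hz'.symm
  have hins : e ∈ s := by
    refine hmax (y := insert e s) ⟨?_, ?_⟩ (Set.subset_insert e s) (Set.mem_insert e s)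
    · rintro i (rfl | hi)
      · exact ⟨hee, by simpa using heI 1⟩
      · exact hsP i hi
    · refine hsep.insert hH hker (fun i hi => (hsP i hi).1) hee fun F p y hF hy => ?_
      refine hψ_ne y ?_
      obtain ⟨hm, h0⟩ := hsum F p hF
      rw [← h0]
      congr 1
      exact Subtype.ext hy.symm
  have hae : π (e * (a * h * β)) = 0 := by
    refine hψ_ne _ ?_
    have h4 := hψ_mul ⟨π e, (hsP e hins).2⟩ (π (a * h * β))
    rw [hψ_s e hins, zero_mul] at h4
    rw [← h4]
    congr 1
    exact Subtype.ext (map_mul _ _ _)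
  rw [hea, mul_assoc, map_mul, ha] at hae
  apply hx
  have h5 := hψ_mul x (π (h * β))
  have h6 : ψ x * π (h * β) = ψ x := by rw [← hβ, map_mul, ← mul_assoc, ← hh]
  rw [h6] at h5
  rw [← h5, ← map_zero ψ]
  congr 1
  exact Subtype.ext hae

lemma IsSplitModJacobson.injective (hH : IsSplitModJacobson H)
    (hcomp : IsRightLinearlyCompact H)
    (hker : ∀ x, π x = 0 ↔ x ∈ TwoSidedIdeal.jacobson (⊥ : TwoSidedIdeal H))
    (hsurj : Function.Surjective π) : Module.Injective Kᵐᵒᵖ K := by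
  refine Module.Baer.injective fun I g => ?_
  let I' : AddSubgroup K := I.toAddSubgroup.comap (MulOpposite.opAddEquiv (α := K)).toAddMonoidHom
  have hI' : ∀ x ∈ I', ∀ y, x * y ∈ I' := fun x hx y => I.mul_mem_left (MulOpposite.op y) hx
  let G : I' →+ K :=
    { toFun := fun x => g ⟨MulOpposite.op x, x.2⟩
      map_zero' := map_zero g
      map_add' := fun x y => map_add g ⟨MulOpposite.op x, x.2⟩ ⟨MulOpposite.op y, y.2⟩ }
  obtain ⟨c, hc⟩ := hH.exists_eq_mul_left hcomp hker hsurj I' hI' G fun x y =>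
    map_smul g (MulOpposite.op y) ⟨MulOpposite.op x, x.2⟩
  refine ⟨{ toFun := fun x => c * x.unop
            map_add' := fun x y => mul_add _ _ _
            map_smul' := fun r x => (mul_assoc c x.unop r.unop).symm }, fun x hx => ?_⟩
  exact (hc ⟨x.unop, hx⟩).symm

end RingTheory
section Semigroup

variable {H : Type*} [Ring H]

/-- A family of closed subsets of a ring: intersections of chains of nonempty closed sets are
closed and nonempty, right translates of closed sets are closed, and so are the solution sets in a
closed set of the equations `y * x = x`. -/
structure IsCompactClosedFamily (closed : Set H → Prop) : Prop where
  sInter_chain : ∀ c : Set (Set H), (∀ C ∈ c, closed C ∧ C.Nonempty) → IsChain (· ⊆ ·) c →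
    c.Nonempty → closed (⋂₀ c) ∧ (⋂₀ c).Nonempty
  image_mul_right : ∀ C, closed C → ∀ x, closed ((· * x) '' C)
  sep_mul_eq : ∀ C, closed C → ∀ x, closed {y ∈ C | y * x = x}

lemma IsCompactClosedFamily.exists_minimal {closed : Set H → Prop}
    (h : IsCompactClosedFamily closed) (P : Set H → Prop)
    (hP : ∀ c : Set (Set H), c.Nonempty → (∀ C ∈ c, P C) → P (⋂₀ c))
    {T : Set H} (hT : closed T) (hne : T.Nonempty) (hPT : P T) :
    ∃ C ⊆ T, Minimal (fun C => (closed C ∧ C.Nonempty) ∧ P C) C :=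
  zorn_superset_nonempty {C | (closed C ∧ C.Nonempty) ∧ P C}
    (fun c hc hchain hcne => ⟨⋂₀ c, ⟨h.sInter_chain c (fun _ hC => (hc hC).1) hchain hcne,
      hP c hcne fun _ hC => (hc hC).2⟩, fun _ hC => Set.sInter_subset_of_mem hC⟩)
    T ⟨⟨hT, hne⟩, hPT⟩

/-- A variant of the Ellis–Numakura lemma: a closed submonoid contains an idempotent which lies
in a minimal left ideal. -/
lemma IsCompactClosedFamily.exists_idempotent {closed : Set H → Prop}
    (h : IsCompactClosedFamily closed) (T : Submonoid H) (hT : closed T) :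
    ∃ ε ∈ T, ε * ε = ε ∧ ∀ t ∈ T, ∃ t' ∈ T, t' * t * ε = ε := by
  obtain ⟨C, hCT, ⟨⟨hC, hCne⟩, hTC⟩, hCmin⟩ := h.exists_minimal
    (fun C => ∀ t ∈ T, ∀ x ∈ C, t * x ∈ C)
    (fun _ _ hc t ht x hx _ hC => hc _ hC t ht x (hx _ hC)) hT ⟨1, T.one_mem⟩
    (fun t ht x hx => T.mul_mem ht hx)
  have hCle : ∀ x ∈ C, C ⊆ (· * x) '' (T : Set H) := by
    intro x hx
    refine hCmin ⟨⟨h.image_mul_right _ hT x, ⟨_, 1, T.one_mem, rfl⟩⟩, ?_⟩ ?_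
    · rintro t ht _ ⟨y, hy, rfl⟩
      exact ⟨t * y, T.mul_mem ht hy, mul_assoc t y x⟩
    · rintro _ ⟨y, hy, rfl⟩
      exact hTC y hy x hx
  obtain ⟨D, hDC, ⟨⟨hD, x, hx⟩, hDD⟩, hDmin⟩ := h.exists_minimal
    (fun D => ∀ x ∈ D, ∀ y ∈ D, x * y ∈ D)
    (fun _ _ hc x hx y hy _ hC => hc _ hC x (hx _ hC) y (hy _ hC)) hC hCne
    (fun x hx y hy => hTC x (hCT hx) y hy)
  have hDx : D ⊆ (· * x) '' D := by
    refine hDmin ⟨⟨h.image_mul_right _ hD x, ⟨_, x, hx, rfl⟩⟩, ?_⟩ ?_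
    · rintro _ ⟨y, hy, rfl⟩ _ ⟨z, hz, rfl⟩
      exact ⟨y * x * z, hDD _ (hDD y hy x hx) z hz, mul_assoc (y * x) z x⟩
    · rintro _ ⟨y, hy, rfl⟩
      exact hDD y hy x hx
  obtain ⟨y, hy, hyx⟩ := hDx hx
  have hDfix : D ⊆ {y ∈ D | y * x = x} := by
    refine hDmin ⟨⟨h.sep_mul_eq _ hD x, ⟨y, hy, hyx⟩⟩, ?_⟩ (Set.sep_subset _ _)
    rintro y ⟨hy, hyx⟩ z ⟨hz, hzx⟩
    exact ⟨hDD y hy z hz, by rw [mul_assoc, hzx, hyx]⟩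
  refine ⟨x, hCT (hDC hx), (hDfix hx).2, fun t ht => ?_⟩
  obtain ⟨t', ht', hxt⟩ := hCle (t * x) (hTC t ht x (hDC hx)) (hDC hx)
  exact ⟨t', ht', (mul_assoc _ _ _).trans hxt⟩

/-- The submonoid `1 + L` attached to a left ideal `L`. -/
def oneSubSubmonoid (L : Ideal H) : Submonoid H where
  carrier := {t | 1 - t ∈ L}
  one_mem' := by simp
  mul_mem' {a b} ha hb := by
    have : 1 - a * b = a * (1 - b) + (1 - a) := by noncomm_ring
    change 1 - a * b ∈ L
    rw [this]
    exact L.add_mem (L.mul_mem_left a hb) ha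

lemma IsCompactClosedFamily.exists_idempotent_mem_ideal {closed : Set H → Prop}
    (h : IsCompactClosedFamily closed) (L : Ideal H) (hL : closed (oneSubSubmonoid L)) :
    ∃ ε ∈ L, ε * ε = ε ∧
      ∀ x ∈ L, x * (1 - ε) ∈ TwoSidedIdeal.jacobson (⊥ : TwoSidedIdeal H) := by
  obtain ⟨ε, hε, hεε, hmin⟩ := h.exists_idempotent _ hL
  refine ⟨1 - ε, hε, by rw [mul_sub, sub_mul, sub_mul, hεε]; noncomm_ring, fun x hx => ?_⟩
  rw [sub_sub_cancel, TwoSidedIdeal.mem_jacobson_iff]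
  intro y
  have ht : 1 + y * x ∈ oneSubSubmonoid L := by
    change 1 - (1 + y * x) ∈ L
    rw [sub_add_cancel_left]
    exact L.neg_mem (L.mul_mem_left y hx)
  obtain ⟨t', -, ht'⟩ := hmin _ ((oneSubSubmonoid L).mul_mem hε ht)
  set t := 1 + y * x with htdef
  set v := ε * t' * ε with hv
  have hvt : v * t * ε = ε := by
    calc v * t * ε = ε * (t' * (ε * t) * ε) := by rw [hv]; noncomm_ring
      _ = ε := by rw [ht', hεε]
  refine ⟨v + (1 - ε) - (1 - ε) * t * v, ?_⟩
  rw [TwoSidedIdeal.mem_bot, sub_eq_zero]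
  have hyx : y * (x * ε) = t * ε - ε := by rw [htdef]; noncomm_ring
  have hvε : v * ε = v := by rw [hv, mul_assoc, hεε]
  have h1 : v * (y * (x * ε)) = ε - v := by rw [hyx, mul_sub, ← mul_assoc, hvt, hvε]
  have h2 : (1 - ε) * (y * (x * ε)) = (1 - ε) * t * ε := by
    rw [hyx, mul_sub, sub_mul 1 ε ε, one_mul, hεε, sub_self, sub_zero, mul_assoc]
  rw [mul_assoc _ y, sub_mul, add_mul, mul_assoc _ v, h1, h2]
  noncomm_ring

end Semigroup
section AlgebraicallyCompact

variable (R : Type u) [Ring R]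

/-- `Q` is algebraically compact: a family of equations `y m = q` in one unknown homomorphism
`y : M → Q` is solvable as soon as all its finite subfamilies are. -/
def IsAlgebraicallyCompact (Q : Type u) [AddCommGroup Q] [Module R Q] : Prop :=
  ∀ (M : ModuleCat.{u} R) (S : Set (M × Q)),
    (∀ F : Finset (M × Q), (F : Set (M × Q)) ⊆ S → ∃ y : M →ₗ[R] Q, ∀ p ∈ F, y p.1 = p.2) →
    ∃ y : M →ₗ[R] Q, ∀ p ∈ S, y p.1 = p.2

variable {Q : Type u} [AddCommGroup Q] [Module R Q]

/-- A set of endomorphisms of `Q` is closed if it consists of the restrictions of the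
homomorphisms `M → Q` satisfying a given family of equations. -/
def IsClosedEndSet (C : Set (Module.End R Q)) : Prop :=
  ∃ (M : ModuleCat.{u} R) (i : Q →ₗ[R] M) (S : Set (M × Q)),
    ∀ h, h ∈ C ↔ ∃ y : M →ₗ[R] Q, (∀ p ∈ S, y p.1 = p.2) ∧ y ∘ₗ i = h

variable {R}

lemma IsAlgebraicallyCompact.sInter_chain (hQ : IsAlgebraicallyCompact R Q)
    (c : Set (Set (Module.End R Q))) (hc : ∀ C ∈ c, IsClosedEndSet R C ∧ C.Nonempty)
    (hchain : IsChain (· ⊆ ·) c) (hne : c.Nonempty) :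
    IsClosedEndSet R (⋂₀ c) ∧ (⋂₀ c).Nonempty := by
  classical
  choose M i S hS using fun C : c => (hc C C.2).1
  let M' : ModuleCat.{u} R := ModuleCat.of R (Q × Π₀ C : c, M C)
  let i' : Q →ₗ[R] M' := LinearMap.inl R Q (Π₀ C : c, M C)
  let P : c → M' × Q → Prop := fun C p =>
    (∃ s ∈ S C, p = (((0, DFinsupp.single C s.1) : Q × Π₀ C : c, M C), s.2)) ∨
      ∃ q : Q, p = (((q, -DFinsupp.single C (i C q)) : Q × Π₀ C : c, M C), 0)
  have key : ∀ (h : Module.End R Q) (y : ∀ C : c, M C →ₗ[R] Q),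
      ∃ z : M' →ₗ[R] Q, z ∘ₗ i' = h ∧
        ∀ C : c, (∀ s ∈ S C, y C s.1 = s.2) → y C ∘ₗ i C = h → ∀ p, P C p → z p.1 = p.2 := by
    intro h y
    refine ⟨LinearMap.coprod h (DFinsupp.lsum ℕ y), ?_, ?_⟩
    · ext q
      change h q + DFinsupp.lsum ℕ y 0 = h q
      rw [map_zero, add_zero]
    · rintro C h1 h2 p (⟨s, hs, rfl⟩ | ⟨q, rfl⟩)
      · change h 0 + DFinsupp.lsum ℕ y (DFinsupp.single C s.1) = s.2
        rw [map_zero, zero_add, DFinsupp.lsum_single, h1 s hs]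
      · change h q + DFinsupp.lsum ℕ y (-DFinsupp.single C (i C q)) = 0
        rw [map_neg, DFinsupp.lsum_single, ← h2]
        exact add_neg_cancel _
  have hclosed : ∀ h, h ∈ ⋂₀ c ↔
      ∃ y : M' →ₗ[R] Q, (∀ p ∈ {p | ∃ C, P C p}, y p.1 = p.2) ∧ y ∘ₗ i' = h := by
    intro h
    constructor
    · intro hh
      choose y hy hy' using fun C : c => (hS C h).1 (hh C C.2)
      obtain ⟨z, hz, hz'⟩ := key h y
      exact ⟨z, fun p ⟨C, hp⟩ => hz' C (hy C) (hy' C) p hp, hz⟩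
    · rintro ⟨z, hz, rfl⟩ C hC
      let f : M ⟨C, hC⟩ →ₗ[R] M' := LinearMap.inr R Q _ ∘ₗ
      DFinsupp.lsingle (M := fun C : c => M C) ⟨C, hC⟩
      refine (hS ⟨C, hC⟩ _).2 ⟨z ∘ₗ f, fun s hs => hz (_, s.2) ⟨⟨C, hC⟩, Or.inl ⟨s, hs, rfl⟩⟩, ?_⟩
      ext q
      have h1 := hz _ ⟨⟨C, hC⟩, Or.inr ⟨q, rfl⟩⟩
      have h2 : (((q, -DFinsupp.single (⟨C, hC⟩ : c) (i ⟨C, hC⟩ q)) : Q × Π₀ C : c, M C) : M') =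
          i' q - f (i ⟨C, hC⟩ q) := by
        refine Prod.ext ?_ ?_
        · change q = q - 0
          rw [sub_zero]
        · change _ = (0 : Π₀ C : c, M C) - DFinsupp.single _ _
          rw [zero_sub]
      dsimp only at h1
      rw [h2, map_sub, sub_eq_zero] at h1
      exact h1.symm
  refine ⟨⟨M', i', _, hclosed⟩, ?_⟩
  have hsolve : ∃ y : M' →ₗ[R] Q, ∀ p ∈ {p | ∃ C, P C p}, y p.1 = p.2 := by
    refine hQ M' _ fun F hF => ?_
    have : Nonempty c := hne.to_subtype
    choose w hw using fun p : F => hF p.2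
    have hdir : Directed (· ⊇ ·) (fun C : c => (C : Set (Module.End R Q))) := by
      intro C D
      rcases hchain.total C.2 D.2 with h | h
      · exact ⟨C, subset_rfl, h⟩
      · exact ⟨D, h, subset_rfl⟩
    obtain ⟨C₀, hC₀⟩ := hdir.finset_le (Finset.univ.image w)
    obtain ⟨h, hh⟩ := (hc C₀ C₀.2).2
    have hy : ∀ C : c, ∃ y : M C →ₗ[R] Q, h ∈ (C : Set (Module.End R Q)) →
        (∀ s ∈ S C, y s.1 = s.2) ∧ y ∘ₗ i C = h := by
      intro C
      by_cases hC : h ∈ (C : Set (Module.End R Q))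
      · obtain ⟨y, hy⟩ := (hS C h).1 hC
        exact ⟨y, fun _ => hy⟩
      · exact ⟨0, fun h => absurd h hC⟩
    choose y hy using hy
    obtain ⟨z, -, hz⟩ := key h y
    refine ⟨z, fun p hp => ?_⟩
    have hpC := hC₀ (w ⟨p, hp⟩) (Finset.mem_image_of_mem _ (Finset.mem_univ _)) hh
    exact hz _ (hy _ hpC).1 (hy _ hpC).2 p (hw ⟨p, hp⟩)
  obtain ⟨y, hy⟩ := hsolve
  exact ⟨_, (hclosed _).2 ⟨y, hy, rfl⟩⟩

lemma IsAlgebraicallyCompact.isCompactClosedFamily (hQ : IsAlgebraicallyCompact R Q) :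
    IsCompactClosedFamily (IsClosedEndSet R (Q := Q)) where
  sInter_chain := hQ.sInter_chain
  image_mul_right := by
    rintro C ⟨M, i, S, hS⟩ x
    refine ⟨M, i ∘ₗ x, S, fun h => ?_⟩
    constructor
    · rintro ⟨g, hg, rfl⟩
      obtain ⟨y, hy, rfl⟩ := (hS g).1 hg
      exact ⟨y, hy, rfl⟩
    · rintro ⟨y, hy, rfl⟩
      exact ⟨_, (hS _).2 ⟨y, hy, rfl⟩, rfl⟩
  sep_mul_eq := by
    rintro C ⟨M, i, S, hS⟩ x
    refine ⟨M, i, S ∪ Set.range fun q => (i (x q), x q), fun h => ?_⟩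
    constructor
    · rintro ⟨hC, hx⟩
      obtain ⟨y, hy, rfl⟩ := (hS h).1 hC
      refine ⟨y, ?_, rfl⟩
      rintro p (hp | ⟨q, rfl⟩)
      · exact hy p hp
      · exact LinearMap.congr_fun hx q
    · rintro ⟨y, hy, rfl⟩
      refine ⟨(hS _).2 ⟨y, fun p hp => hy p (Or.inl hp), rfl⟩, LinearMap.ext fun q => ?_⟩
      exact hy _ (Or.inr ⟨q, rfl⟩)

lemma isClosedEndSet_oneSub_span_singleton (a : Module.End R Q) :
    IsClosedEndSet R (oneSubSubmonoid (Ideal.span {a}) : Set (Module.End R Q)) := by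
  refine ⟨ModuleCat.of R (Q × Q), LinearMap.prod LinearMap.id (-a),
    Set.range fun q : Q => (((q, 0) : Q × Q), q), fun h => ?_⟩
  have hmem : h ∈ (oneSubSubmonoid (Ideal.span {a}) : Set (Module.End R Q)) ↔
    ∃ k, k * a = 1 - h := Ideal.mem_span_singleton'
  rw [hmem]
  constructor
  · rintro ⟨k, hk⟩
    refine ⟨LinearMap.coprod LinearMap.id k, ?_, ?_⟩
    · rintro _ ⟨q, rfl⟩
      change q + k 0 = q
      rw [map_zero, add_zero]
    · ext q
      have h1 : k (a q) = q - h q := LinearMap.congr_fun hk q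
      change q + k (-a q) = h q
      rw [map_neg, h1]
      abel
  · rintro ⟨y, hy, rfl⟩
    refine ⟨y ∘ₗ LinearMap.inr R Q Q, LinearMap.ext fun q => ?_⟩
    have h1 : y ((q, 0) : Q × Q) = q := hy _ ⟨q, rfl⟩
    change y ((0, a q) : Q × Q) = q - y ((q, -a q) : Q × Q)
    conv_rhs => rw [← h1]
    rw [h1]
    conv_rhs => enter [1]; rw [← h1]
    rw [← map_sub]
    congr 1
    exact Prod.ext (sub_self q).symm (by change _ = 0 - - a q; simp)

lemma isClosedEndSet_oneSub_annihilator {A : Type u} [AddCommGroup A] [Module R A]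
    (e : A →ₗ[R] Q) (L : Ideal (Module.End R Q)) (hL : ∀ f, f ∈ L ↔ f ∘ₗ e = 0) :
    IsClosedEndSet R (oneSubSubmonoid L : Set (Module.End R Q)) := by
  refine ⟨ModuleCat.of R Q, LinearMap.id, Set.range fun a => (e a, e a), fun h => ?_⟩
  have hmem : h ∈ (oneSubSubmonoid L : Set (Module.End R Q)) ↔ ∀ a, h (e a) = e a := by
    refine (hL _).trans ⟨fun H a => ?_, fun H => LinearMap.ext fun a => ?_⟩
    · exact (sub_eq_zero.1 (LinearMap.congr_fun H a)).symm
    · change e a - h (e a) = 0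
      rw [H, sub_self]
  rw [hmem]
  constructor
  · intro H
    refine ⟨h, ?_, rfl⟩
    rintro _ ⟨a, rfl⟩
    exact H a
  · rintro ⟨y, hy, rfl⟩ a
    exact hy _ ⟨a, rfl⟩

lemma IsAlgebraicallyCompact.isSplitModJacobson (hQ : IsAlgebraicallyCompact R Q) :
    IsSplitModJacobson (Module.End R Q) := by
  intro a
  obtain ⟨ε, hε, hεε, hJ⟩ := hQ.isCompactClosedFamily.exists_idempotent_mem_ideal _
    (isClosedEndSet_oneSub_span_singleton a)
  obtain ⟨h, rfl⟩ := Ideal.mem_span_singleton'.1 hε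
  refine ⟨h, hεε, ?_⟩
  have := hJ a (Ideal.mem_span_singleton_self a)
  rwa [mul_sub, mul_one, ← mul_assoc] at this

lemma IsAlgebraicallyCompact.isRightLinearlyCompact (hQ : IsAlgebraicallyCompact R Q) :
    IsRightLinearlyCompact (Module.End R Q) := by
  classical
  intro s b hs
  obtain ⟨y, hy⟩ := hQ (ModuleCat.of R Q) {p | ∃ e ∈ s, ∃ q : Q, p = (e q, b e q)} fun F hF => by
    choose e he q hq using fun p : F => hF p.2
    obtain ⟨c, hc⟩ := hs (Finset.univ.image e) (by
      intro x hx
      obtain ⟨p, -, rfl⟩ := Finset.mem_image.1 hx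
      exact he p)
    refine ⟨c, fun p hp => ?_⟩
    have h1 := LinearMap.congr_fun (hc _ (Finset.mem_image_of_mem e (Finset.mem_univ ⟨p, hp⟩)))
      (q ⟨p, hp⟩)
    have h2 := hq ⟨p, hp⟩
    exact (congrArg (fun p => c p.1) h2).trans (h1.trans (congrArg Prod.snd h2).symm)
  exact ⟨y, fun e he => LinearMap.ext fun q => hy _ ⟨e, he, q, rfl⟩⟩

end AlgebraicallyCompact
section ConeatInjective

variable {R : Type u} [Ring R]

lemma map_mem_rIdealSMul {B C : Type u} [AddCommGroup B] [Module R B] [AddCommGroup C] [Module R C]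
    (f : B →ₗ[R] C) {I : Ideal Rᵐᵒᵖ} {X : Set B} {x : B} (hx : x ∈ rIdealSMul R I X) :
    f x ∈ rIdealSMul R I (f '' X) := by
  have h : rIdealSMul R I X ≤ (rIdealSMul R I (f '' X)).comap f.toAddMonoidHom := by
    refine (AddSubgroup.closure_le _).2 ?_
    rintro _ ⟨i, hi, n, hn, rfl⟩
    exact AddSubgroup.subset_closure ⟨i, hi, f n, ⟨n, hn, rfl⟩, map_smul f _ _⟩
  exact h hx

lemma rIdealSMul_mono {B : Type u} [AddCommGroup B] [Module R B] (I : Ideal Rᵐᵒᵖ) {X Y : Set B}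
    (h : X ⊆ Y) : rIdealSMul R I X ≤ rIdealSMul R I Y :=
  AddSubgroup.closure_mono fun _ ⟨i, hi, n, hn, hx⟩ => ⟨i, hi, n, h hn, hx⟩

lemma IsConeatInjective.exists_extension {M A B : Type u} [AddCommGroup M] [Module R M]
    [AddCommGroup A] [Module R A] [AddCommGroup B] [Module R B] (hM : IsConeatInjective R M)
    (j : A →ₗ[R] B) (hj : Function.Injective j) (hrange : IsConeatSubmodule R (LinearMap.range j))
    (f : A →ₗ[R] M) : ∃ g : B →ₗ[R] M, g ∘ₗ j = f := by
  obtain ⟨g, hg⟩ := hM (ModuleCat.of R B) _ hrange (f ∘ₗ (LinearEquiv.ofInjective j hj).symm)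
  refine ⟨g, LinearMap.ext fun a => ?_⟩
  have := LinearMap.congr_fun hg (LinearEquiv.ofInjective j hj a)
  simpa using this

/-- The pushout of `Q` along a finitely solvable family of equations is a locally split, hence
coneat, extension of `Q`. -/
lemma IsConeatInjective.isAlgebraicallyCompact {Q : Type u} [AddCommGroup Q] [Module R Q]
    (hQ : IsConeatInjective R Q) : IsAlgebraicallyCompact R Q := by
  classical
  intro M S hS
  let t : M × Q → Q × M := fun p => (p.2, -p.1)
  let N : Submodule R (Q × M) := Submodule.span R (t '' S)
  let j : Q →ₗ[R] (Q × M) ⧸ N := N.mkQ ∘ₗ LinearMap.inl R Q M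
  have hlocal : ∀ n ∈ N, ∃ y : M →ₗ[R] Q, n.1 + y n.2 = 0 := by
    intro n hn
    obtain ⟨T, hT, hnT⟩ := Submodule.mem_span_finite_of_mem_span hn
    obtain ⟨F, hF, rfl⟩ := Finset.subset_set_image_iff.1 hT
    obtain ⟨y, hy⟩ := hS F hF
    refine ⟨y, ?_⟩
    have hle : Submodule.span R ((F.image t : Finset (Q × M)) : Set (Q × M)) ≤
        LinearMap.ker (LinearMap.coprod LinearMap.id y) := by
      refine Submodule.span_le.2 ?_
      intro z hz
      obtain ⟨p, hp, rfl⟩ := Finset.mem_image.1 hz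
      change p.2 + y (-p.1) = 0
      rw [map_neg, hy p hp, add_neg_cancel]
    exact hle hnT
  have hj : Function.Injective j := by
    rw [injective_iff_map_eq_zero]
    intro q hq
    obtain ⟨y, hy⟩ := hlocal _ ((Submodule.Quotient.mk_eq_zero N).1 hq)
    simpa using hy
  have hconeat : IsConeatSubmodule R (LinearMap.range j) := by
    rintro I - _ ⟨q, rfl⟩ hq
    have hlift : ∀ b ∈ rIdealSMul R I (Set.univ : Set ((Q × M) ⧸ N)),
        ∃ w ∈ rIdealSMul R I (Set.univ : Set (Q × M)), N.mkQ w = b := by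
      have hle : rIdealSMul R I (Set.univ : Set ((Q × M) ⧸ N)) ≤
          (rIdealSMul R I (Set.univ : Set (Q × M))).map N.mkQ.toAddMonoidHom := by
        refine (AddSubgroup.closure_le _).2 ?_
        rintro _ ⟨i, hi, n, -, rfl⟩
        obtain ⟨n, rfl⟩ := N.mkQ_surjective n
        exact ⟨_, AddSubgroup.subset_closure ⟨i, hi, n, trivial, rfl⟩, map_smul N.mkQ _ _⟩
      exact fun b hb => hle hb
    obtain ⟨w, hw, hwq⟩ := hlift _ hq
    have hmem : (q, 0) - w ∈ N := by
      rw [← Submodule.Quotient.mk_eq_zero, ← Submodule.mkQ_apply, map_sub, hwq]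
      exact sub_self _
    obtain ⟨y, hy⟩ := hlocal _ hmem
    have hqw : LinearMap.coprod LinearMap.id y w = q := by
      rw [LinearMap.coprod_apply, LinearMap.id_apply]
      have h0 : q - w.1 + y (0 - w.2) = 0 := hy
      rw [zero_sub, map_neg, ← sub_eq_add_neg, sub_sub, sub_eq_zero] at h0
      exact h0.symm
    have h1 := map_mem_rIdealSMul (j ∘ₗ LinearMap.coprod LinearMap.id y) hw
    rw [LinearMap.comp_apply, hqw] at h1
    refine rIdealSMul_mono I ?_ h1
    rintro _ ⟨z, -, rfl⟩
    exact ⟨_, rfl⟩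
  obtain ⟨g, hg⟩ := hQ.exists_extension j hj hconeat LinearMap.id
  refine ⟨g ∘ₗ N.mkQ ∘ₗ LinearMap.inr R Q M, fun p hp => ?_⟩
  have h1 : N.mkQ (t p) = 0 :=
    (Submodule.Quotient.mk_eq_zero N).2 (Submodule.subset_span ⟨p, hp, rfl⟩)
  have h2 : t p = LinearMap.inl R Q M p.2 - LinearMap.inr R Q M p.1 :=
    Prod.ext (sub_zero p.2).symm (zero_sub p.1).symm
  rw [h2, map_sub, sub_eq_zero] at h1
  change g (N.mkQ (LinearMap.inr R Q M p.1)) = p.2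
  rw [← h1]
  exact LinearMap.congr_fun hg p.2

lemma IsConeatInjective.of_retract {Q E : Type u} [AddCommGroup Q] [Module R Q] [AddCommGroup E]
    [Module R E] (hQ : IsConeatInjective R Q) (i : E →ₗ[R] Q) (p : Q →ₗ[R] E)
    (hpi : p ∘ₗ i = LinearMap.id) : IsConeatInjective R E := by
  intro B A hA f
  obtain ⟨g, hg⟩ := hQ B A hA (i ∘ₗ f)
  refine ⟨p ∘ₗ g, ?_⟩
  rw [LinearMap.comp_assoc, hg, ← LinearMap.comp_assoc, hpi, LinearMap.id_comp]

lemma IsConeatInjective.pi {ι : Type u} (D : ι → Type u) [∀ k, AddCommGroup (D k)]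
    [∀ k, Module R (D k)] (hD : ∀ k, IsConeatInjective R (D k)) :
    IsConeatInjective R (∀ k, D k) := by
  intro B A hA f
  choose g hg using fun k => hD k B A hA (LinearMap.proj k ∘ₗ f)
  exact ⟨LinearMap.pi g, LinearMap.ext fun a => funext fun k => LinearMap.congr_fun (hg k) a⟩

/-- The character module of the right module `R ⧸ I`, as a left `R`-module of characters of `R`
vanishing on the right ideal `I`. -/
def QuotientCharacter (I : Ideal Rᵐᵒᵖ) : Type u :=
  ({ carrier := {χ | ∀ i ∈ I, χ (MulOpposite.unop i) = 0}
     zero_mem' := fun _ _ => rfl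
     add_mem' := fun {a b} ha hb i hi => by
       rw [AddMonoidHom.add_apply, ha i hi, hb i hi, add_zero]
     neg_mem' := fun {a} ha i hi => by
       rw [AddMonoidHom.neg_apply, ha i hi, neg_zero] } : AddSubgroup (R →+ AddCircle (1 : ℚ)))

namespace QuotientCharacter

variable (I : Ideal Rᵐᵒᵖ)

instance : AddCommGroup (QuotientCharacter I) :=
  inferInstanceAs (AddCommGroup (AddSubgroup.mk _ _ : AddSubgroup (R →+ AddCircle (1 : ℚ))))

variable {I}

lemma apply_eq_zero (χ : QuotientCharacter I) {i : Rᵐᵒᵖ} (hi : i ∈ I) :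
    χ.1 (MulOpposite.unop i) = 0 :=
  χ.2 i hi

lemma ext_apply {χ ψ : QuotientCharacter I} (h : ∀ s, χ.1 s = ψ.1 s) : χ = ψ :=
  Subtype.ext (AddMonoidHom.ext h)

instance : Module R (QuotientCharacter I) where
  smul r χ := ⟨χ.1.comp (AddMonoidHom.mulRight r), fun i hi =>
    χ.2 (MulOpposite.op r * i) (I.mul_mem_left _ hi)⟩
  one_smul χ := ext_apply fun s => congrArg χ.1 (mul_one s)
  mul_smul r r' χ := ext_apply fun s => congrArg χ.1 (mul_assoc s r r').symm
  smul_zero _ := rfl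
  smul_add _ _ _ := rfl
  add_smul r r' χ := ext_apply fun s => (congrArg χ.1 (mul_add s r r')).trans (map_add χ.1 _ _)
  zero_smul χ := ext_apply fun s => (congrArg χ.1 (mul_zero s)).trans (map_zero χ.1)

variable (I) in
/-- Evaluation at `1`. -/
def evalOne : QuotientCharacter I →+ AddCircle (1 : ℚ) where
  toFun χ := χ.1 1
  map_zero' := rfl
  map_add' _ _ := rfl

variable {B : Type u} [AddCommGroup B] [Module R B]

lemma evalOne_eq_zero {X : Set (QuotientCharacter I)} {χ : QuotientCharacter I}
    (hχ : χ ∈ rIdealSMul R I X) : evalOne I χ = 0 := by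
  have hle : rIdealSMul R I X ≤ (evalOne I).ker := by
    refine (AddSubgroup.closure_le _).2 ?_
    rintro _ ⟨i, hi, n, -, rfl⟩
    change n.1 (1 * i.unop) = 0
    rw [one_mul, n.apply_eq_zero hi]
  exact hle hχ

/-- The homomorphism attached to a character vanishing on `I • B`. -/
def lift (χ : B →+ AddCircle (1 : ℚ)) (hχ : ∀ b ∈ rIdealSMul R I (Set.univ : Set B), χ b = 0) :
    B →ₗ[R] QuotientCharacter I where
  toFun b := ⟨χ.comp (AddMonoidHom.flip (AddMonoidHom.smul : R →+ B →+ B) b), fun i hi =>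
    hχ _ (AddSubgroup.subset_closure ⟨i, hi, b, trivial, rfl⟩)⟩
  map_add' b b' := ext_apply fun s => (congrArg χ (smul_add s b b')).trans (map_add χ _ _)
  map_smul' r b := ext_apply fun s => congrArg χ (mul_smul s r b).symm

end QuotientCharacter

lemma exists_character_extension {B : Type u} [AddCommGroup B] (A K : AddSubgroup B)
    (χ : A →+ AddCircle (1 : ℚ)) (hχ : ∀ a : A, (a : B) ∈ K → χ a = 0) :
    ∃ ψ : B →+ AddCircle (1 : ℚ), (∀ b ∈ K, ψ b = 0) ∧ ∀ a : A, ψ a = χ a := by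
  let f : A →+ B ⧸ K := (QuotientAddGroup.mk' K).comp A.subtype
  have hf : f.ker ≤ χ.ker := fun a ha =>
    hχ a ((QuotientAddGroup.eq_zero_iff (a : B)).1 ha)
  obtain ⟨ψ, hψ⟩ := (Module.Baer.of_divisible (AddCircle (1 : ℚ))).extension_property_addMonoidHom
    (QuotientAddGroup.kerLift f) (QuotientAddGroup.kerLift_injective f)
    (QuotientAddGroup.lift f.ker χ hf)
  refine ⟨ψ.comp (QuotientAddGroup.mk' K), fun b hb => ?_, fun a => ?_⟩
  · have : (QuotientAddGroup.mk' K) b = 0 := (QuotientAddGroup.eq_zero_iff b).2 hb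
    rw [AddMonoidHom.comp_apply, this, map_zero]
  · exact DFunLike.congr_fun hψ (QuotientAddGroup.mk a)

lemma exists_character_apply_ne_zero {B : Type u} [AddCommGroup B] (K : AddSubgroup B) {b : B}
    (hb : b ∉ K) : ∃ ψ : B →+ AddCircle (1 : ℚ), (∀ x ∈ K, ψ x = 0) ∧ ψ b ≠ 0 := by
  have hne : (QuotientAddGroup.mk' K) b ≠ 0 := fun h => hb ((QuotientAddGroup.eq_zero_iff b).1 h)
  obtain ⟨c, hc⟩ := CharacterModule.exists_character_apply_ne_zero_of_ne_zero hne
  let c' : B ⧸ K →+ AddCircle (1 : ℚ) := c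
  refine ⟨c'.comp (QuotientAddGroup.mk' K), fun x hx => ?_, hc⟩
  have : (QuotientAddGroup.mk' K) x = 0 := (QuotientAddGroup.eq_zero_iff x).2 hx
  rw [AddMonoidHom.comp_apply, this, map_zero]

lemma eq_zero_of_mem_rIdealSMul_bot {B : Type u} [AddCommGroup B] [Module R B] {X : Set B} {b : B}
    (hb : b ∈ rIdealSMul R ⊥ X) : b = 0 := by
  have hle : rIdealSMul R ⊥ X ≤ (⊥ : AddSubgroup B) := by
    refine (AddSubgroup.closure_le _).2 ?_
    rintro _ ⟨i, hi, n, -, rfl⟩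
    rw [(Submodule.mem_bot _).1 hi]
    exact zero_smul R n
  exact hle hb

lemma isConeatInjective_quotientCharacter {I : Ideal Rᵐᵒᵖ} (hI : I.IsMaximal ∨ I = ⊥) :
    IsConeatInjective R (QuotientCharacter I) := by
  intro B A hA f
  have hAI : ∀ a : B, a ∈ A → a ∈ rIdealSMul R I (Set.univ : Set B) →
      a ∈ rIdealSMul R I (A : Set B) := by
    rcases hI with hI | rfl
    · exact hA I hI
    · intro a _ ha
      rw [eq_zero_of_mem_rIdealSMul_bot ha]
      exact zero_mem _
  let χ : A.toAddSubgroup →+ AddCircle (1 : ℚ) :=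
    (QuotientCharacter.evalOne I).comp f.toAddMonoidHom
  obtain ⟨ψ, hψK, hψ⟩ := exists_character_extension A.toAddSubgroup
    (rIdealSMul R I (Set.univ : Set B)) χ fun a ha => by
      have hmem : a ∈ rIdealSMul R I (Set.univ : Set A) := by
        have hle : rIdealSMul R I (A : Set B) ≤
            (rIdealSMul R I (Set.univ : Set A)).map A.subtype.toAddMonoidHom := by
          refine (AddSubgroup.closure_le _).2 ?_
          rintro _ ⟨i, hi, n, hn, rfl⟩
          exact ⟨i.unop • ⟨n, hn⟩, AddSubgroup.subset_closure ⟨i, hi, ⟨n, hn⟩, trivial, rfl⟩, rfl⟩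
        obtain ⟨a', ha', h⟩ := hle (hAI a a.2 ha)
        rwa [← Subtype.ext (a1 := a') (a2 := a) h]
      exact QuotientCharacter.evalOne_eq_zero (map_mem_rIdealSMul f hmem)
  refine ⟨QuotientCharacter.lift ψ hψK, LinearMap.ext fun a =>
    QuotientCharacter.ext_apply fun s => ?_⟩
  have h1 : ψ (s • (a : B)) = (f (s • a)).1 1 := hψ (s • a)
  have h2 : (f (s • a)).1 1 = (f a).1 s := by
    rw [map_smul f]
    exact congrArg (f a).1 (one_mul s)
  exact h1.trans h2

/-- Every module is a coneat submodule of a coneat injective module. -/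
lemma exists_coneat_embedding (A : Type u) [AddCommGroup A] [Module R A] :
    ∃ (Q : ModuleCat.{u} R) (e : A →ₗ[R] Q), IsConeatInjective R Q ∧ Function.Injective e ∧
      IsConeatSubmodule R (LinearMap.range e) := by
  let ι : Type u := {k : Ideal Rᵐᵒᵖ × (A →+ AddCircle (1 : ℚ)) //
    (k.1.IsMaximal ∨ k.1 = ⊥) ∧ ∀ a ∈ rIdealSMul R k.1 (Set.univ : Set A), k.2 a = 0}
  let Q : Type u := ∀ k : ι, QuotientCharacter k.1.1
  let e : A →ₗ[R] Q := LinearMap.pi fun k => QuotientCharacter.lift k.1.2 k.2.2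
  have he : ∀ (k : ι) (a : A), (e a k).1 1 = k.1.2 a := fun k a =>
    congrArg k.1.2 (one_smul R a)
  have hinj : Function.Injective e := by
    rw [injective_iff_map_eq_zero]
    intro a ha
    by_contra hne
    obtain ⟨χ, hχ, hχa⟩ := exists_character_apply_ne_zero
      (rIdealSMul R ⊥ (Set.univ : Set A)) fun h => hne (eq_zero_of_mem_rIdealSMul_bot h)
    refine hχa ?_
    rw [← he ⟨(⊥, χ), Or.inr rfl, hχ⟩ a, ha]
    rfl
  refine ⟨ModuleCat.of R Q, e, IsConeatInjective.pi _ fun k =>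
    isConeatInjective_quotientCharacter k.2.1, hinj, ?_⟩
  rintro I hI _ ⟨a, rfl⟩ ha
  have hmem : a ∈ rIdealSMul R I (Set.univ : Set A) := by
    by_contra hne
    obtain ⟨χ, hχ, hχa⟩ := exists_character_apply_ne_zero _ hne
    let k : ι := ⟨(I, χ), Or.inl hI, hχ⟩
    refine hχa ?_
    rw [← he k a]
    exact QuotientCharacter.evalOne_eq_zero
      (map_mem_rIdealSMul (LinearMap.proj k : Q →ₗ[R] QuotientCharacter k.1.1) ha)
  have h1 := map_mem_rIdealSMul e hmem
  rwa [Set.image_univ] at h1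

end ConeatInjective

section Envelope

variable {R : Type u} [Ring R]

lemma isUnit_one_sub_of_mem_jacobson {H : Type*} [Ring H] {j : H}
    (hj : j ∈ TwoSidedIdeal.jacobson (⊥ : TwoSidedIdeal H)) : IsUnit (1 - j) := by
  obtain ⟨z, hz⟩ := exists_mul_one_sub_eq_one_of_mem_jacobson hj
  obtain ⟨w, hw⟩ := exists_mul_one_sub_eq_one_of_mem_jacobson
    (TwoSidedIdeal.neg_mem _ (TwoSidedIdeal.mul_mem_left _ z j hj))
  have h1 : 1 - -(z * j) = z := by
    rw [mul_sub, mul_one] at hz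
    rw [← hz]
    abel
  rw [h1] at hw
  have h2 : w = 1 - j := left_inv_eq_right_inv hw hz
  exact ⟨⟨1 - j, z, h2 ▸ hw, hz⟩, rfl⟩

/-- Every module has a coneat injective envelope. -/
lemma exists_coneatInjectiveEnvelope (A : Type u) [AddCommGroup A] [Module R A] :
    ∃ (E : ModuleCat.{u} R) (e : A →ₗ[R] E), IsConeatInjectiveEnvelope R e := by
  obtain ⟨Q, e, hQ, he, hrange⟩ := exists_coneat_embedding (R := R) A
  let L : Ideal (Module.End R Q) :=
    { carrier := {f | f ∘ₗ e = 0}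
      add_mem' := fun {f g} hf hg => by
        change (f + g) ∘ₗ e = 0
        rw [LinearMap.add_comp, hf, hg, add_zero]
      zero_mem' := LinearMap.zero_comp e
      smul_mem' := fun c f hf => by
        change (c ∘ₗ f) ∘ₗ e = 0
        rw [LinearMap.comp_assoc, hf, LinearMap.comp_zero] }
  have hL : ∀ f, f ∈ L ↔ f ∘ₗ e = 0 := fun _ => Iff.rfl
  obtain ⟨ε, hεL, hε, hJ⟩ := hQ.isAlgebraicallyCompact.isCompactClosedFamily
    |>.exists_idempotent_mem_ideal L (isClosedEndSet_oneSub_annihilator e L hL)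
  let q : Module.End R Q := 1 - ε
  have hq : q * q = q := by
    change (1 - ε) * (1 - ε) = 1 - ε
    rw [mul_sub, mul_one, sub_mul, one_mul, hε, sub_self, sub_zero]
  let i : LinearMap.range q →ₗ[R] Q := (LinearMap.range q).subtype
  let p : Q →ₗ[R] LinearMap.range q := q.rangeRestrict
  have hi : Function.Injective i := Subtype.val_injective
  have hip : ∀ x, i (p x) = q x := fun _ => rfl
  have hpi : ∀ x, p (i x) = x := by
    rintro ⟨_, y, rfl⟩
    exact Subtype.ext (LinearMap.congr_fun hq y)
  have hqe : ∀ a, q (e a) = e a := fun a => by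
    have h := LinearMap.congr_fun ((hL ε).1 hεL) a
    change e a - ε (e a) = e a
    rw [show ε (e a) = 0 from h, sub_zero]
  have hE : IsConeatInjective R (LinearMap.range q) :=
    hQ.of_retract i p (LinearMap.ext hpi)
  have hinj : Function.Injective (p ∘ₗ e) := fun a b h => he <| by
    rw [← hqe a, ← hqe b]
    exact congrArg i h
  have hconeat : IsConeatSubmodule R (LinearMap.range (p ∘ₗ e)) := by
    rintro I hI _ ⟨a, rfl⟩ ha
    have h1 : e a ∈ rIdealSMul R I (Set.univ : Set Q) := by
      have h := rIdealSMul_mono I (Set.subset_univ _) (map_mem_rIdealSMul i ha)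
      rwa [LinearMap.comp_apply, hip, hqe] at h
    have h2 := map_mem_rIdealSMul p (hrange I hI _ ⟨a, rfl⟩ h1)
    refine rIdealSMul_mono I ?_ h2
    rintro _ ⟨_, ⟨b, rfl⟩, rfl⟩
    exact ⟨b, rfl⟩
  refine ⟨ModuleCat.of R (LinearMap.range q), p ∘ₗ e, hinj, hE, fun C hC g =>
    hC.exists_extension (p ∘ₗ e) hinj hconeat g, fun (f : LinearMap.range q →ₗ[R] _) hf => ?_⟩
  have hfe : ∀ a, f (p (e a)) = p (e a) := fun a => LinearMap.congr_fun hf a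
  let j : Module.End R Q := q - i ∘ₗ f ∘ₗ p
  have hjL : j ∈ L := (hL j).2 <| LinearMap.ext fun a => by
    change q (e a) - i (f (p (e a))) = 0
    rw [hfe, hip, sub_self]
  have hjq : j * (1 - ε) = j := by
    refine LinearMap.ext fun x => ?_
    change q (q x) - i (f (p (q x))) = q x - i (f (p x))
    rw [show q (q x) = q x from LinearMap.congr_fun hq x, ← hip, hpi]
  have hu := (Module.End.isUnit_iff _).1 (isUnit_one_sub_of_mem_jacobson (hjq ▸ hJ j hjL))
  have hux : ∀ x, (1 - j) x = ε x + i (f (p x)) := fun x => by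
    change x - (x - ε x - i (f (p x))) = _
    abel
  have hεq : ∀ x, ε (q x) = 0 := fun x => by
    change ε (x - ε x) = 0
    rw [map_sub, show ε (ε x) = ε x from LinearMap.congr_fun hε x, sub_self]
  have hεi : ∀ x, ε (i x) = 0 := fun x => by rw [← hpi x, hip, hεq]
  have hui : ∀ x, (1 - j) (i x) = i (f x) := fun x => by rw [hux, hεi, zero_add, hpi]
  refine ⟨fun x y hxy => hi (hu.1 ?_), fun y => ?_⟩
  · rw [hui, hui]
    exact congrArg i hxy
  · obtain ⟨w, hw⟩ := hu.2 (i y)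
    refine ⟨p w, hi ?_⟩
    have h := congrArg q hw
    have hqε : q (ε w) = 0 := by
      change ε w - ε (ε w) = 0
      rw [show ε (ε w) = ε w from LinearMap.congr_fun hε w, sub_self]
    rw [hux, map_add, hqε, zero_add, ← hip, ← hip, hpi, hpi] at h
    exact h

/-- The restriction of endomorphisms of `E` to a fully invariant submodule `e : A → E`. -/
lemma exists_restriction_ringHom {A E : Type u} [AddCommGroup A] [Module R A] [AddCommGroup E]
    [Module R E] {e : A →ₗ[R] E} (he : Function.Injective e)
    (hinv : ∀ (f : A →ₗ[R] E) (a : A), f a ∈ LinearMap.range e) :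
    ∃ ρ : Module.End R E →+* Module.End R A, ∀ h a, e (ρ h a) = h (e a) := by
  let r : Module.End R E → Module.End R A := fun h =>
    (LinearEquiv.ofInjective e he).symm ∘ₗ (h ∘ₗ e).codRestrict _ (hinv (h ∘ₗ e))
  have hr : ∀ h a, e (r h a) = h (e a) := fun h a =>
    congrArg Subtype.val ((LinearEquiv.ofInjective e he).apply_symm_apply
      ((h ∘ₗ e).codRestrict _ (hinv (h ∘ₗ e)) a))
  have hext : ∀ (h : Module.End R E) (g : Module.End R A), (∀ a, e (g a) = h (e a)) → r h = g :=
    fun h g hg => LinearMap.ext fun a => he ((hr h a).trans (hg a).symm)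
  exact ⟨{ toFun := r
           map_one' := hext _ _ fun a => rfl
           map_zero' := hext _ _ fun a => map_zero e
           map_mul' := fun h k => hext _ _ fun a => by
             rw [Module.End.mul_apply, hr, hr, Module.End.mul_apply]
           map_add' := fun h k => hext _ _ fun a => by
             rw [LinearMap.add_apply, map_add, hr, hr, LinearMap.add_apply] }, hr⟩

/-- A surjective ring homomorphism reflects the Jacobson radical if `1 + k` is invertible for
all `k` in its kernel. -/
lemma mem_jacobson_iff_of_surjective {H K : Type*} [Ring H] [Ring K] {ρ : H →+* K}
    (hsurj : Function.Surjective ρ) (hker : ∀ k, ρ k = 0 → IsUnit (1 + k)) (x : H) :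
    ρ x ∈ TwoSidedIdeal.jacobson (⊥ : TwoSidedIdeal K) ↔
      x ∈ TwoSidedIdeal.jacobson (⊥ : TwoSidedIdeal H) := by
  simp only [TwoSidedIdeal.mem_jacobson_iff, TwoSidedIdeal.mem_bot]
  refine ⟨fun h y => ?_, fun h y => ?_⟩
  · obtain ⟨z', hz⟩ := h (ρ y)
    obtain ⟨z, rfl⟩ := hsurj z'
    obtain ⟨u, hu⟩ := hker (z * y * x + z - 1) (by simpa using hz)
    refine ⟨↑u⁻¹ * z, ?_⟩
    have h1 : (u : H) = z * y * x + z := by rw [hu]; abel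
    rw [sub_eq_zero, ← u.inv_mul, h1]
    noncomm_ring
  · obtain ⟨y, rfl⟩ := hsurj y
    obtain ⟨z, hz⟩ := h y
    exact ⟨ρ z, by simpa using congrArg ρ hz⟩

end Envelope

/-- If `A` is a coneat quasi injective left `R`-module, then
`End_R(A) ⧸ J(End_R(A))` is a von Neumann regular ring which is injective as a right module
over itself. -/
theorem endomorphism_ring_of_coneatQuasiInjective (R : Type u) [Ring R]
    (A : Type u) [AddCommGroup A] [Module R A] (hA : IsConeatQuasiInjective R A) :
    (∀ t : (TwoSidedIdeal.jacobson (⊥ : TwoSidedIdeal (Module.End R A))).ringCon.Quotient,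
      ∃ u, t = t * u * t) ∧
    Module.Injective
      ((TwoSidedIdeal.jacobson (⊥ : TwoSidedIdeal (Module.End R A))).ringCon.Quotient)ᵐᵒᵖ
      (TwoSidedIdeal.jacobson (⊥ : TwoSidedIdeal (Module.End R A))).ringCon.Quotient := by
  obtain ⟨E, e, henv⟩ := exists_coneatInjectiveEnvelope (R := R) A
  obtain ⟨ρ, hρ⟩ := exists_restriction_ringHom henv.1 (hA E e henv)
  have hρsurj : Function.Surjective ρ := fun f => by
    obtain ⟨h, hh⟩ := henv.2.2.1 E henv.2.1 (e ∘ₗ f)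
    exact ⟨h, LinearMap.ext fun a => henv.1 ((hρ h a).trans (LinearMap.congr_fun hh a))⟩
  have hρker : ∀ k, ρ k = 0 → IsUnit (1 + k) := fun k hk => by
    refine (Module.End.isUnit_iff _).2 (henv.2.2.2 (1 + k) (LinearMap.ext fun a => ?_))
    change e a + k (e a) = e a
    rw [← hρ, hk, LinearMap.zero_apply, map_zero, add_zero]
  let J := TwoSidedIdeal.jacobson (⊥ : TwoSidedIdeal (Module.End R A))
  let π : Module.End R E →+* J.ringCon.Quotient := J.ringCon.mk'.comp ρ
  have hπsurj : Function.Surjective π := J.ringCon.mk'_surjective.comp hρsurj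
  have hπker : ∀ x, π x = 0 ↔ x ∈ TwoSidedIdeal.jacobson (⊥ : TwoSidedIdeal (Module.End R E)) :=
    fun x => by
      rw [← mem_jacobson_iff_of_surjective hρsurj hρker, TwoSidedIdeal.mem_iff]
      exact J.ringCon.eq
  have hE := henv.2.1.isAlgebraicallyCompact
  exact ⟨hE.isSplitModJacobson.exists_eq_mul_mul hπker hπsurj,
    hE.isSplitModJacobson.injective hE.isRightLinearlyCompact hπker hπsurj⟩
end

section
/- The following are equivalent for a ring R: (1) R is a right SF-ring, i.e. every simple right R-module is flat; (2) every coneat injective left R-module is injective; (3) every left R-module is coneat regular, i.e. every submodule of every left R-module is a coneat submodule; (4) every short exact sequence of left R-modules is coneat exact. Moreover, if R is commutative, these conditions are equivalent to R being von Neumann regular. -/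
/-!
Basic notions from the theory of coneat exact sequences.

A short exact sequence `0 → A → B → C → 0` of left `R`-modules is *coneat exact* if for every
simple right `R`-module `S` the induced map `S ⊗[R] A → S ⊗[R] B` is injective.  Since every
simple right `R`-module is isomorphic to `R ⧸ I` for a maximal right ideal `I` (realized below
as a left ideal `I : Ideal Rᵐᵒᵖ`), and since `(R ⧸ I) ⊗[R] B ≅ B ⧸ I•B` (as abelian groups,
where `I•B` is the additive subgroup generated by the products `i • b`, `i ∈ I`, `b ∈ B`),
this is equivalent to the elementwise condition `A ∩ I•B ⊆ I•A` for every maximal right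
ideal `I`, which is the formulation used here (Mathlib has no tensor product of a right module
with a left module over a noncommutative ring).
-/

universe u v

section SFRing

open MulOpposite

variable {R : Type u} [Ring R]

/-- Every maximal right ideal `I` satisfies `a ∈ I * a` for each `a ∈ I`; this says that each right
module `R ⧸ I` is flat. -/
def MaximalRightIdealsFixElements (R : Type u) [Ring R] : Prop :=
  ∀ I : Ideal Rᵐᵒᵖ, I.IsMaximal → ∀ a : R, op a ∈ I → ∃ e : R, op e ∈ I ∧ e * a = a

theorem maximalRightIdealsFixElements_of_flat
    (h : ∀ S : ModuleCat.{u} Rᵐᵒᵖ, IsSimpleModule Rᵐᵒᵖ S → IsFlatRightModule R S) :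
    MaximalRightIdealsFixElements R := by
  intro I hI a ha
  have hs : IsSimpleModule Rᵐᵒᵖ (Rᵐᵒᵖ ⧸ I) := isSimpleModule_iff_isCoatom.2 hI.out
  obtain ⟨n, b, t, hst, hb⟩ := h (ModuleCat.of Rᵐᵒᵖ (Rᵐᵒᵖ ⧸ I)) hs 1 (fun _ => a)
    (fun _ => I.mkQ 1) (by
      rw [Fin.sum_univ_one]
      change op a • I.mkQ 1 = 0
      rw [← map_smul, Submodule.mkQ_apply, Submodule.Quotient.mk_eq_zero]
      simpa using ha)
  choose r hr using fun j => I.mkQ_surjective (t j)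
  refine ⟨1 - ∑ j, unop (r j) * b j 0, ?_, ?_⟩
  · rw [← Submodule.Quotient.mk_eq_zero I, ← Submodule.mkQ_apply]
    have h1 : I.mkQ 1 = ∑ j, op (b j 0) • I.mkQ (r j) := by
      simpa only [hr] using hst 0
    have h2 : op (1 - ∑ j, unop (r j) * b j 0) = 1 - ∑ j, op (b j 0) • r j := by
      apply unop_injective
      simp [Finset.unop_sum]
    rw [h2, map_sub, map_sum, h1]
    simp only [map_smul, sub_self]
  · have h0 : ∀ j, b j 0 * a = 0 := fun j => by simpa using hb j
    simp [sub_mul, Finset.sum_mul, mul_assoc, h0]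

theorem MaximalRightIdealsFixElements.flat (h : MaximalRightIdealsFixElements R)
    (S : Type u) [AddCommGroup S] [Module Rᵐᵒᵖ S] [IsSimpleModule Rᵐᵒᵖ S] :
    IsFlatRightModule R S := by
  intro m a s hs
  have : Nontrivial S := IsSimpleModule.nontrivial Rᵐᵒᵖ S
  obtain ⟨x, hx⟩ := exists_ne (0 : S)
  have hsurj := IsSimpleModule.toSpanSingleton_surjective Rᵐᵒᵖ hx
  choose r hr using fun i => hsurj (s i)
  simp only [LinearMap.toSpanSingleton_apply] at hr
  have hI := IsSimpleModule.ker_toSpanSingleton_isMaximal Rᵐᵒᵖ hx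
  obtain ⟨e, he, hea⟩ := h _ hI (∑ i, unop (r i) * a i) (by
    rw [LinearMap.mem_ker, LinearMap.toSpanSingleton_apply, ← hs]
    simp only [Finset.op_sum, op_mul, op_unop, Finset.sum_smul, mul_smul, hr])
  rw [LinearMap.mem_ker, LinearMap.toSpanSingleton_apply] at he
  refine ⟨1, fun _ i => (1 - e) * unop (r i), fun _ => x, fun i => ?_, fun _ => ?_⟩
  · simp [mul_smul, sub_smul, he, hr]
  · simp only [mul_assoc, ← Finset.mul_sum]
    rw [sub_mul, one_mul, hea, sub_self]

theorem MaximalRightIdealsFixElements.exists_smul_eq (h : MaximalRightIdealsFixElements R)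
    {B : Type v} [AddCommGroup B] [Module R B] {I : Ideal Rᵐᵒᵖ} (hI : I.IsMaximal) {N : Set B}
    {x : B} (hx : x ∈ rIdealSMul R I N) : ∃ e : R, op e ∈ I ∧ e • x = x := by
  suffices H : ∀ e : R, op e ∈ I →
      ∃ f : R, op f ∈ I ∧ (∃ u : R, 1 - f = u * (1 - e)) ∧ f • x = x by
    obtain ⟨f, hf, -, hfx⟩ := H 0 (by simp)
    exact ⟨f, hf, hfx⟩
  induction hx using AddSubgroup.closure_induction with
  | mem x hx =>
    obtain ⟨i, hi, n, -, rfl⟩ := hx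
    intro e he
    obtain ⟨g, hg, hgi⟩ := h I hI ((1 - e) * unop i) (by
      rw [sub_mul, one_mul, op_sub, op_mul]
      exact I.sub_mem hi (I.mul_mem_left _ he))
    have key : 1 - (e + g - g * e) = (1 - g) * (1 - e) := by noncomm_ring
    refine ⟨e + g - g * e, ?_, ⟨1 - g, key⟩, ?_⟩
    · rw [op_sub, op_add, op_mul]
      exact I.sub_mem (I.add_mem he hg) (I.mul_mem_left _ hg)
    · rw [eq_comm, ← sub_eq_zero, ← one_smul R (unop i • n), smul_smul _ (1 : R), ← sub_smul,
        mul_one, key, smul_smul, mul_assoc, sub_mul 1 g, one_mul, hgi, sub_self, zero_smul]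
  | zero => exact fun e he => ⟨e, he, ⟨1, by simp⟩, by simp⟩
  | add x y _ _ hx hy =>
    intro e he
    obtain ⟨f, hf, ⟨u, hu⟩, hfx⟩ := hx e he
    obtain ⟨g, hg, ⟨w, hw⟩, hgy⟩ := hy f hf
    refine ⟨g, hg, ⟨w * u, by rw [hw, hu, mul_assoc]⟩, ?_⟩
    have hgx : (1 - g) • x = 0 := by rw [hw, mul_smul, sub_smul, hfx]; simp
    rw [sub_smul, one_smul, sub_eq_zero] at hgx
    rw [smul_add, ← hgx, hgy]
  | neg x _ hx =>
    intro e he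
    obtain ⟨f, hf, hu, hfx⟩ := hx e he
    exact ⟨f, hf, hu, by rw [smul_neg, hfx]⟩

theorem MaximalRightIdealsFixElements.isConeatSubmodule (h : MaximalRightIdealsFixElements R)
    {B : Type v} [AddCommGroup B] [Module R B] (A : Submodule R B) : IsConeatSubmodule R A := by
  intro I hI a ha haB
  obtain ⟨e, he, hea⟩ := h.exists_smul_eq hI haB
  exact AddSubgroup.subset_closure ⟨op e, he, a, ha, hea.symm⟩

theorem maximalRightIdealsFixElements_of_isConeatSubmodule
    (h : ∀ A : Submodule R R, IsConeatSubmodule R A) : MaximalRightIdealsFixElements R := by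
  intro I hI a ha
  have hmem := h (R ∙ a) I hI a (Submodule.mem_span_singleton_self a)
    (AddSubgroup.subset_closure ⟨op a, ha, 1, Set.mem_univ _, by simp⟩)
  suffices H : ∀ x ∈ rIdealSMul R I ((R ∙ a : Submodule R R) : Set R),
      ∃ e : R, op e ∈ I ∧ e * a = x from H a hmem
  intro x hx
  induction hx using AddSubgroup.closure_induction with
  | mem x hx =>
    obtain ⟨i, hi, n, hn, rfl⟩ := hx
    obtain ⟨r, rfl⟩ := Submodule.mem_span_singleton.1 hn
    exact ⟨unop i * r, by simpa using I.mul_mem_left (op r) hi, by simp [mul_assoc]⟩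
  | zero => exact ⟨0, by simp, by simp⟩
  | add x y _ _ hx hy =>
    obtain ⟨e, he, rfl⟩ := hx
    obtain ⟨f, hf, rfl⟩ := hy
    exact ⟨e + f, I.add_mem he hf, add_mul ..⟩
  | neg x _ hx =>
    obtain ⟨e, he, rfl⟩ := hx
    exact ⟨-e, I.neg_mem he, neg_mul ..⟩

/-- The character group of `R ⧸ I`, for a right ideal `I` : the additive characters of `R` that
vanish on `I`. -/
def rightQuotientDual (I : Ideal Rᵐᵒᵖ) : AddSubgroup (R →+ AddCircle (1 : ℚ)) where
  carrier := {f | ∀ i ∈ I, f (unop i) = 0}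
  zero_mem' _ _ := rfl
  add_mem' hf hg i hi := by simp [hf i hi, hg i hi]
  neg_mem' hf i hi := by simp [hf i hi]

noncomputable instance (I : Ideal Rᵐᵒᵖ) : Module R (rightQuotientDual I) where
  smul r f := ⟨f.1.comp (AddMonoidHom.mulRight r), fun i hi => by
    simpa using f.2 (op r * i) (I.mul_mem_left _ hi)⟩
  one_smul f := Subtype.ext <| AddMonoidHom.ext fun x => congrArg f.1 (mul_one x)
  mul_smul r s f := Subtype.ext <| AddMonoidHom.ext fun x =>
    congrArg f.1 (mul_assoc x r s).symm
  smul_zero _ := rfl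
  smul_add _ _ _ := rfl
  add_smul r s f := Subtype.ext <| AddMonoidHom.ext fun x =>
    (congrArg f.1 (mul_add x r s)).trans (map_add f.1 _ _)
  zero_smul f := Subtype.ext <| AddMonoidHom.ext fun x =>
    (congrArg f.1 (mul_zero x)).trans (map_zero f.1)

theorem rightQuotientDual_smul_apply {I : Ideal Rᵐᵒᵖ} (r : R) (f : rightQuotientDual I) (x : R) :
    (r • f).1 x = f.1 (x * r) :=
  rfl

/-- A character of `B` vanishing on `I • B` induces a linear map from `B` to the character module
of `R ⧸ I`. -/
noncomputable def homRightQuotientDual {B : Type v} [AddCommGroup B] [Module R B]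
    (I : Ideal Rᵐᵒᵖ) (χ : B →+ AddCircle (1 : ℚ)) (hχ : ∀ i ∈ I, ∀ b, χ (unop i • b) = 0) :
    B →ₗ[R] rightQuotientDual I where
  toFun b := ⟨χ.comp ((LinearMap.toSpanSingleton R B b).toAddMonoidHom), fun i hi => hχ i hi b⟩
  map_add' b c := Subtype.ext <| AddMonoidHom.ext fun x =>
    (congrArg χ (smul_add x b c)).trans (map_add χ _ _)
  map_smul' r b := Subtype.ext <| AddMonoidHom.ext fun x => congrArg χ (smul_smul x r b)

theorem homRightQuotientDual_apply {B : Type v} [AddCommGroup B] [Module R B]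
    {I : Ideal Rᵐᵒᵖ} {χ : B →+ AddCircle (1 : ℚ)} {hχ : ∀ i ∈ I, ∀ b, χ (unop i • b) = 0}
    (b : B) (x : R) : (homRightQuotientDual I χ hχ b).1 x = χ (x • b) :=
  rfl

theorem exists_character_comp_eq {A : Type*} {B : Type*} [AddCommGroup A] [AddCommGroup B]
    (h : A →+ B) (ψ : A →+ AddCircle (1 : ℚ)) (hψ : h.ker ≤ ψ.ker) :
    ∃ χ : B →+ AddCircle (1 : ℚ), χ.comp h = ψ := by
  obtain ⟨χ, hχ⟩ := (Module.Baer.of_divisible (AddCircle (1 : ℚ))).extension_property_addMonoidHom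
    (QuotientAddGroup.kerLift h) (QuotientAddGroup.kerLift_injective h)
    (QuotientAddGroup.lift h.ker ψ hψ)
  exact ⟨χ, AddMonoidHom.ext fun a => DFunLike.congr_fun hχ (a : A ⧸ h.ker)⟩

theorem isConeatInjective_rightQuotientDual (I : Ideal Rᵐᵒᵖ) (hI : I.IsMaximal) :
    IsConeatInjective R (rightQuotientDual I) := by
  intro B A hA f
  let ψ : A →+ AddCircle (1 : ℚ) :=
    { toFun := fun a => (f a).1 1
      map_zero' := by simp
      map_add' := fun a b => by simp }
  have hψ : ∀ (r : R) (a : A), ψ (r • a) = (f a).1 r := fun r a => by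
    change (f (r • a)).1 1 = _
    rw [map_smul, rightQuotientDual_smul_apply, one_mul]
  let N := rIdealSMul R I (Set.univ : Set B)
  have hker : ((QuotientAddGroup.mk' N).comp A.subtype.toAddMonoidHom).ker ≤ ψ.ker := by
    intro a ha
    have haN : (a : B) ∈ N := (QuotientAddGroup.eq_zero_iff _).1 ha
    suffices H : ∀ x ∈ rIdealSMul R I (A : Set B), ∃ hx : x ∈ A, ψ ⟨x, hx⟩ = 0 from
      (H _ (hA I hI a a.2 haN)).2
    intro x hx
    induction hx using AddSubgroup.closure_induction with
    | mem x hx =>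
      obtain ⟨i, hi, n, hn, rfl⟩ := hx
      exact ⟨A.smul_mem _ hn, (hψ (unop i) ⟨n, hn⟩).trans ((f ⟨n, hn⟩).2 i hi)⟩
    | zero => exact ⟨A.zero_mem, map_zero ψ⟩
    | add x y _ _ hx hy =>
      obtain ⟨hxA, hx⟩ := hx
      obtain ⟨hyA, hy⟩ := hy
      refine ⟨A.add_mem hxA hyA, (map_add ψ ⟨x, hxA⟩ ⟨y, hyA⟩).trans ?_⟩
      rw [hx, hy, add_zero]
    | neg x _ hx =>
      obtain ⟨hxA, hx⟩ := hx
      exact ⟨A.neg_mem hxA, (map_neg ψ ⟨x, hxA⟩).trans (by rw [hx, neg_zero])⟩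
  obtain ⟨χ, hχ⟩ := exists_character_comp_eq _ ψ hker
  refine ⟨homRightQuotientDual I (χ.comp (QuotientAddGroup.mk' N)) fun i hi b => ?_, ?_⟩
  · have hb : (QuotientAddGroup.mk' N) (unop i • b) = 0 := (QuotientAddGroup.eq_zero_iff _).2
      (AddSubgroup.subset_closure ⟨i, hi, b, Set.mem_univ _, rfl⟩)
    rw [AddMonoidHom.comp_apply, hb, map_zero]
  · refine LinearMap.ext fun a => Subtype.ext <| AddMonoidHom.ext fun x => ?_
    exact (DFunLike.congr_fun hχ (x • a)).trans (hψ x a)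

theorem maximalRightIdealsFixElements_of_injective
    (h : ∀ M : ModuleCat.{u} R, IsConeatInjective R M → Module.Injective R M) :
    MaximalRightIdealsFixElements R := by
  intro I hI a ha
  have hinj : Module.Injective R (rightQuotientDual I) :=
    h (ModuleCat.of R (rightQuotientDual I)) (isConeatInjective_rightQuotientDual I hI)
  let N : AddSubgroup R := I.toAddSubgroup.map
    ((AddMonoidHom.mulRight a).comp (opAddEquiv (α := R)).symm.toAddMonoidHom)
  suffices haN : a ∈ N by
    obtain ⟨e, he, hea⟩ := haN
    exact ⟨unop e, he, hea⟩
  by_contra haN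
  obtain ⟨c, hc⟩ := CharacterModule.exists_character_apply_ne_zero_of_ne_zero
    (mt (QuotientAddGroup.eq_zero_iff (N := N) a).1 haN)
  let χ : R →+ AddCircle (1 : ℚ) := AddMonoidHom.comp c (QuotientAddGroup.mk' N)
  have hχN : ∀ x ∈ N, χ x = 0 := fun x hx => by
    change c (x : R ⧸ N) = 0
    rw [(QuotientAddGroup.eq_zero_iff x).2 hx, map_zero]
  let φ : (R ∙ a) →ₗ[R] rightQuotientDual I :=
    homRightQuotientDual I (χ.comp (R ∙ a).subtype.toAddMonoidHom) fun i hi b => by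
      obtain ⟨b, hb⟩ := b
      obtain ⟨r, rfl⟩ := Submodule.mem_span_singleton.1 hb
      exact hχN _ ⟨op r * i, I.mul_mem_left _ hi, mul_assoc (unop i) r a⟩
  obtain ⟨g, hg⟩ := hinj.out (R ∙ a).subtype (R ∙ a).injective_subtype φ
  have h1 : (g a).1 1 = χ a := by
    have := congrArg (fun f => f.1 1) (hg ⟨a, Submodule.mem_span_singleton_self a⟩)
    simpa [φ, homRightQuotientDual_apply] using this
  have h2 : (g a).1 1 = 0 := by
    rw [← mul_one a, ← smul_eq_mul, map_smul, rightQuotientDual_smul_apply, one_mul]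
    exact (g 1).2 (op a) ha
  exact hc (h1.symm.trans h2)

theorem maximalRightIdealsFixElements_of_vonNeumannRegular (h : ∀ a : R, ∃ x : R, a = a * x * a) :
    MaximalRightIdealsFixElements R := by
  intro I _ a ha
  obtain ⟨x, hx⟩ := h a
  exact ⟨a * x, I.mul_mem_left (op x) ha, hx.symm⟩

theorem MaximalRightIdealsFixElements.vonNeumannRegular (h : MaximalRightIdealsFixElements R)
    (hcomm : ∀ a b : R, a * b = b * a) (a : R) : ∃ x : R, a = a * x * a := by
  let J : Ideal Rᵐᵒᵖ :=
    { carrier := {z | ∃ x, unop z * a = a * x * a}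
      zero_mem' := ⟨0, by simp⟩
      add_mem' := by
        rintro y z ⟨r, hr⟩ ⟨s, hs⟩
        exact ⟨r + s, by rw [unop_add, add_mul, hr, hs, mul_add, add_mul]⟩
      smul_mem' := by
        rintro r z ⟨x, hx⟩
        refine ⟨x * unop r, ?_⟩
        rw [smul_eq_mul, unop_mul, mul_assoc, hcomm (unop r), ← mul_assoc, hx]
        simp only [mul_assoc, hcomm (unop r) a] }
  suffices hJ : (1 : Rᵐᵒᵖ) ∈ J by
    obtain ⟨x, hx⟩ := hJ
    exact ⟨x, by simpa using hx⟩
  by_contra hJ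
  obtain ⟨I, hI, hJI⟩ := Ideal.exists_le_maximal J ((Ideal.ne_top_iff_one J).2 hJ)
  obtain ⟨e, he, hea⟩ := h I hI a (hJI ⟨1, by simp⟩)
  have h1 : op (1 - e) ∈ I := hJI ⟨0, by simp [sub_mul, hea]⟩
  refine (Ideal.ne_top_iff_one I).1 hI.ne_top ?_
  simpa using I.add_mem h1 he

end SFRing

/-- The following are equivalent for a ring `R`: (1) `R` is a right SF-ring
(every simple right `R`-module is flat); (2) every coneat injective left `R`-module is
injective; (3) every submodule of every left `R`-module is coneat; (4) every short exact
sequence of left `R`-modules is coneat exact. Moreover, if `R` is commutative these are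
equivalent to `R` being von Neumann regular. -/
theorem sf_ring_tfae (R : Type u) [Ring R] :
    (((∀ S : ModuleCat.{u} Rᵐᵒᵖ, IsSimpleModule Rᵐᵒᵖ S → IsFlatRightModule R S) ↔
        (∀ M : ModuleCat.{u} R, IsConeatInjective R M → Module.Injective R M)) ∧
      ((∀ M : ModuleCat.{u} R, IsConeatInjective R M → Module.Injective R M) ↔
        (∀ (B : ModuleCat.{u} R) (A : Submodule R B), IsConeatSubmodule R A)) ∧
      ((∀ (B : ModuleCat.{u} R) (A : Submodule R B), IsConeatSubmodule R A) ↔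
        (∀ (A B C : ModuleCat.{u} R) (f : A →ₗ[R] B) (g : B →ₗ[R] C),
          Function.Injective f → Function.Surjective g → Function.Exact f g →
          IsConeatExactSeq R f g))) ∧
    ((∀ a b : R, a * b = b * a) →
      ((∀ S : ModuleCat.{u} Rᵐᵒᵖ, IsSimpleModule Rᵐᵒᵖ S → IsFlatRightModule R S) ↔
        ∀ a : R, ∃ x : R, a = a * x * a)) := by
  have flat_iff : (∀ S : ModuleCat.{u} Rᵐᵒᵖ, IsSimpleModule Rᵐᵒᵖ S → IsFlatRightModule R S) ↔
      MaximalRightIdealsFixElements R :=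
    ⟨maximalRightIdealsFixElements_of_flat, fun h S _ => h.flat S⟩
  have coneat_iff : (∀ (B : ModuleCat.{u} R) (A : Submodule R B), IsConeatSubmodule R A) ↔
      MaximalRightIdealsFixElements R :=
    ⟨fun h => maximalRightIdealsFixElements_of_isConeatSubmodule (h (ModuleCat.of R R)),
      fun h B A => h.isConeatSubmodule A⟩
  have injective_iff : (∀ M : ModuleCat.{u} R, IsConeatInjective R M → Module.Injective R M) ↔
      MaximalRightIdealsFixElements R := by
    refine ⟨maximalRightIdealsFixElements_of_injective, fun h M hM => ⟨?_⟩⟩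
    intro X Y _ _ _ _ f hf g
    let e := LinearEquiv.ofInjective f hf
    obtain ⟨k, hk⟩ := hM (ModuleCat.of R Y) (LinearMap.range f) (h.isConeatSubmodule _)
      (g.comp e.symm.toLinearMap)
    refine ⟨k, fun x => ?_⟩
    simpa [e] using LinearMap.congr_fun hk (e x)
  refine ⟨⟨flat_iff.trans injective_iff.symm, injective_iff.trans coneat_iff.symm,
    fun h A B C f g hf hg hfg => ⟨hf, hg, hfg, h B _⟩, fun h B A => ?_⟩, fun hcomm => ?_⟩
  · have := (h (ModuleCat.of R A) B (ModuleCat.of R (B ⧸ A)) A.subtype A.mkQ A.injective_subtype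
      A.mkQ_surjective (LinearMap.exact_subtype_mkQ A)).2.2.2
    rwa [Submodule.range_subtype] at this
  · exact flat_iff.trans ⟨fun h => h.vonNeumannRegular hcomm,
      maximalRightIdealsFixElements_of_vonNeumannRegular⟩
end
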